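/- arXiv:1005.0129 — 3 statements merged into one kernel-verified Lean document; each statement's English description precedes it below -/
import Mathlib

section
/- For every integer n ≥ 2, the Černý automaton 𝒞_n is synchronizing and its reset length (the minimum length of a reset word) is exactly (n−1)². -/
/-- The two input letters of the automaton. -/
inductive Letter | a | b

/-- Transition function of the Černý automaton `𝒞ₙ` on states `{1, …, n}`:
`δ(i,a) = i` for `i < n`, `δ(n,a) = 1`, `δ(i,b) = i+1` for `i < n`, `δ(n,b) = 1`. -/
def delta (n : ℕ) (q : ℕ) : Letter → ℕ
  | Letter.a => if q < n then q else 1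
  | Letter.b => if q < n then q + 1 else 1

/-- `w` is a reset word: it sends every state in `{1, …, n}` to one single state. -/
def IsReset (n : ℕ) (w : List Letter) : Prop :=
  ∃ p : ℕ, ∀ q ∈ Finset.Icc 1 n, w.foldl (delta n) q = p

/-- The cyclic arc of `d` consecutive states of `{1, …, n}` ending at state `e`,
where `0 ≤ e < n` and `e = 0` stands for the state `n`. -/
def InArc (n d e q : ℕ) : Prop :=
  (q ≤ e ∧ e < q + d) ∨ (e < q ∧ e + n < q + d)

/-- Every word `w` leaves a long arc of states that it does not send to `p`: the potential
`n * d + e` of the arc drops by at most one per letter, reading `w` from right to left. -/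
theorem exists_arc_avoiding (n : ℕ) (hn : 2 ≤ n) (p : ℕ) (w : List Letter) :
    ∃ d e : ℕ, d < n ∧ e < n ∧ n * (n - 1) ≤ n * d + e + w.length ∧
      ∀ q, 1 ≤ q → q ≤ n → InArc n d e q → w.foldl (delta n) q ≠ p := by
  induction w with
  | nil =>
    by_cases hp : 1 ≤ p ∧ p ≤ n
    · refine ⟨n - 1, p - 1, by omega, by omega, by simp only [List.length_nil]; omega, ?_⟩
      intro q h1 h2 h3
      simp only [InArc, List.foldl_nil] at h3 ⊢
      omega
    · refine ⟨n - 1, 0, by omega, by omega, by simp, ?_⟩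
      intro q h1 h2 _
      simp only [List.foldl_nil]
      omega
  | cons x w ih =>
    obtain ⟨d, e, hd, he, hle, h⟩ := ih
    simp only [List.length_cons, List.foldl_cons]
    cases x with
    | a =>
      rcases Nat.eq_zero_or_pos e with rfl | he0
      · rcases Nat.eq_zero_or_pos d with rfl | hd0
        · refine ⟨0, 0, hd, he, by omega, ?_⟩
          intro q h1 h2 h3
          simp only [InArc] at h3
          omega
        · obtain ⟨c, rfl⟩ : ∃ c, d = c + 1 := ⟨d - 1, by omega⟩
          refine ⟨c, n - 1, by omega, by omega, by rw [Nat.mul_succ] at hle; omega, ?_⟩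
          intro q h1 h2 h3
          simp only [InArc] at h h3
          have hq : q < n := by omega
          simp only [delta, hq, if_true]
          exact h q h1 h2 (by omega)
      · refine ⟨d, e, hd, he, by omega, ?_⟩
        intro q h1 h2 h3
        simp only [InArc] at h h3
        simp only [delta]
        split_ifs
        · exact h q h1 h2 h3
        · exact h 1 le_rfl (by omega) (by omega)
    | b =>
      rcases Nat.eq_zero_or_pos e with rfl | he0
      · refine ⟨d, n - 1, hd, by omega, by omega, ?_⟩
        intro q h1 h2 h3
        simp only [InArc] at h h3
        simp only [delta]
        split_ifs
        · exact h (q + 1) (by omega) (by omega) (by omega)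
        · exact h 1 le_rfl (by omega) (by omega)
      · refine ⟨d, e - 1, hd, by omega, by omega, ?_⟩
        intro q h1 h2 h3
        simp only [InArc] at h h3
        simp only [delta]
        split_ifs
        · exact h (q + 1) (by omega) (by omega) (by omega)
        · exact h 1 le_rfl (by omega) (by omega)

theorem IsReset.sq_le_length {n : ℕ} (hn : 2 ≤ n) {w : List Letter} (hw : IsReset n w) :
    (n - 1) ^ 2 ≤ w.length := by
  obtain ⟨p, hp⟩ := hw
  obtain ⟨d, e, hd, he, hle, h⟩ := exists_arc_avoiding n hn p w
  rcases Nat.eq_zero_or_pos d with rfl | hd0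
  · obtain ⟨m, rfl⟩ : ∃ m, n = m + 1 := ⟨n - 1, by omega⟩
    simp only [Nat.add_sub_cancel] at hle ⊢
    nlinarith
  · exfalso
    rcases Nat.eq_zero_or_pos e with rfl | he0
    · exact h n (by omega) le_rfl (Or.inr (by omega)) (hp n (Finset.mem_Icc.2 (by omega)))
    · exact h e he0 he.le (Or.inl (by omega)) (hp e (Finset.mem_Icc.2 (by omega)))

theorem foldl_delta_replicate_b (n j q : ℕ) (h1 : 1 ≤ q) (h2 : q ≤ n) (hj : j ≤ n) :
    (List.replicate j Letter.b).foldl (delta n) q = if q + j ≤ n then q + j else q + j - n := by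
  induction j generalizing q with
  | zero => simp [h2]
  | succ j ih =>
    simp only [List.replicate_succ, List.foldl_cons, delta]
    by_cases hq : q < n
    · rw [if_pos hq, ih (q + 1) (by omega) (by omega) (by omega)]
      split_ifs <;> omega
    · rw [if_neg hq, ih 1 le_rfl (by omega) (by omega)]
      split_ifs <;> omega

/-- The word `bⁿ⁻¹a` moves each state below `n` one step down towards `1`. -/
theorem foldl_delta_block (n q : ℕ) (h1 : 1 ≤ q) (h2 : q < n) :
    (List.replicate (n - 1) Letter.b ++ [Letter.a]).foldl (delta n) q = max 1 (q - 1) := by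
  rw [List.foldl_append, foldl_delta_replicate_b n _ q h1 h2.le (by omega)]
  simp only [List.foldl_cons, List.foldl_nil, delta]
  split_ifs <;> omega

theorem foldl_delta_blocks (n k q : ℕ) (h1 : 1 ≤ q) (h2 : q ≤ k + 1) (hk : k + 1 < n) :
    (List.replicate k (List.replicate (n - 1) Letter.b ++ [Letter.a])).flatten.foldl
      (delta n) q = 1 := by
  induction k generalizing q with
  | zero => simp only [List.replicate_zero, List.flatten_nil, List.foldl_nil]; omega
  | succ k ih =>
    rw [List.replicate_succ, List.flatten_cons, List.foldl_append,
      foldl_delta_block n q h1 (by omega)]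
    exact ih _ (by omega) (by omega) (by omega)

/-- The Černý automaton `𝒞ₙ` is synchronizing and its reset length is exactly `(n-1)²`. -/
theorem cerny_automaton_reset_length (n : ℕ) (hn : 2 ≤ n) :
    IsLeast {L : ℕ | ∃ w : List Letter, IsReset n w ∧ w.length = L} ((n - 1) ^ 2) := by
  refine ⟨⟨Letter.a ::
    (List.replicate (n - 2) (List.replicate (n - 1) Letter.b ++ [Letter.a])).flatten,
    ⟨1, fun q hq => ?_⟩, ?_⟩, ?_⟩
  · rw [Finset.mem_Icc] at hq
    simp only [List.foldl_cons, delta]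
    split_ifs <;>
      exact foldl_delta_blocks _ _ _ (by omega) (by omega) (by omega)
  · obtain ⟨m, rfl⟩ : ∃ m, n = m + 2 := ⟨n - 2, by omega⟩
    simp
    ring
  · rintro L ⟨w, hw, rfl⟩
    exact hw.sq_le_length hn
end

section
/- For every integer n ≥ 2, every reset word for the Černý automaton 𝒞_n has length at least (n−1)². -/
/-- The number of forward steps along the cycle `1, …, n` leading from `c` to `g`. -/
def cycleDist (n c g : ℕ) : ℕ := if c ≤ g then g - c else n + g - c

/-- The weight of a state `c` relative to a distinguished state `g`: one letter lowers it by at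
most one, provided `g` survives whenever it is merged with another state. -/
def weight (n c g : ℕ) : ℕ := n * cycleDist n c g + (n - c)

theorem delta_mem_Icc {n q : ℕ} (hq : q ∈ Set.Icc 1 n) (x : Letter) :
    delta n q x ∈ Set.Icc 1 n := by
  obtain ⟨h1, h2⟩ := hq
  cases x <;> simp only [delta, Set.mem_Icc] <;> split_ifs <;> omega

theorem weight_le_delta_b {n c g : ℕ} (hc : c ∈ Set.Icc 1 n) (hg : g ∈ Set.Icc 1 n) :
    weight n c g ≤ weight n (delta n c .b) (delta n g .b) + 1 := by
  obtain ⟨hc1, hcn⟩ := hc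
  obtain ⟨hg1, hgn⟩ := hg
  have hd : cycleDist n (delta n c .b) (delta n g .b) = cycleDist n c g := by
    simp only [cycleDist, delta]
    split_ifs <;> omega
  have hm : n - c ≤ n - delta n c .b + 1 := by
    simp only [delta]
    split_ifs <;> omega
  simp only [weight, hd]
  omega

theorem weight_le_delta_a {n c g : ℕ} (hc : c ∈ Set.Icc 1 n) (hg : g ∈ Set.Icc 1 n)
    (h : g = n → c ≠ 1) :
    weight n c g ≤ weight n (delta n c .a) (delta n g .a) + 1 := by
  obtain ⟨hc1, hcn⟩ := hc
  obtain ⟨hg1, hgn⟩ := hg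
  rcases hcn.lt_or_eq with hc' | rfl
  · have hd : cycleDist n c g ≤ cycleDist n c (delta n g .a) := by
      simp only [cycleDist, delta]
      split_ifs <;> omega
    have hm := Nat.mul_le_mul_left n hd
    have hca : delta n c .a = c := by simp [delta, hc']
    simp only [weight, hca]
    omega
  · rcases hgn.lt_or_eq with hg' | rfl
    · have hd : cycleDist c c g = cycleDist c 1 g + 1 := by
        simp only [cycleDist]
        split_ifs <;> omega
      have hca : delta c c .a = 1 := by simp [delta]
      have hga : delta c g .a = g := by simp [delta, hg']
      simp only [weight, hca, hga, hd, mul_add]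
      omega
    · simp [weight, cycleDist]

/-- Among states of `S` with the same image under a letter, one can be chosen that is
a suitable distinguished state for the whole of `S`. -/
theorem exists_weight_le_delta {n : ℕ} (hn : 1 < n) {S : Set ℕ} (hS : S ⊆ Set.Icc 1 n) (x : Letter)
    {q : ℕ} (hq : q ∈ S) :
    ∃ g ∈ S, ∀ c ∈ S, weight n c g ≤ weight n (delta n c x) (delta n q x) + 1 := by
  cases x with
  | b => exact ⟨q, hq, fun c hc => weight_le_delta_b (hS hc) (hS hq)⟩
  | a =>
    by_cases h : q = n ∧ 1 ∈ S
    · obtain ⟨rfl, h1⟩ := h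
      refine ⟨1, h1, fun c hc => ?_⟩
      have hd : delta q 1 .a = delta q q .a := by simp [delta]
      rw [← hd]
      exact weight_le_delta_a (hS hc) (hS h1) fun h1q => absurd h1q hn.ne
    · exact ⟨q, hq, fun c hc =>
        weight_le_delta_a (hS hc) (hS hq) fun hqn hc1 => h ⟨hqn, hc1 ▸ hc⟩⟩

theorem exists_weight_le_length {n p : ℕ} (hn : 1 < n) (w : List Letter) {S : Set ℕ}
    (hS : S ⊆ Set.Icc 1 n) (hne : S.Nonempty) (hw : ∀ q ∈ S, w.foldl (delta n) q = p) :
    ∃ g ∈ S, ∀ c ∈ S, weight n c g ≤ w.length + (n - 1) := by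
  induction w generalizing S with
  | nil =>
    obtain ⟨g, hg⟩ := hne
    refine ⟨g, hg, fun c hc => ?_⟩
    have hcg : c = g := (hw c hc).trans (hw g hg).symm
    have := (hS hg).1
    simp only [weight, cycleDist, hcg, le_refl, if_true, Nat.sub_self, List.length_nil]
    omega
  | cons x w ih =>
    obtain ⟨_, ⟨q, hq, rfl⟩, hle⟩ := ih (S := (delta n · x) '' S)
      (Set.image_subset_iff.2 fun q hq => delta_mem_Icc (hS hq) x) (hne.image _)
      (Set.forall_mem_image.2 fun q hq => hw q hq)
    obtain ⟨g, hg, hgle⟩ := exists_weight_le_delta hn hS x hq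
    refine ⟨g, hg, fun c hc => (hgle c hc).trans ?_⟩
    have : weight n (delta n c x) (delta n q x) ≤ w.length + (n - 1) :=
      hle _ (Set.mem_image_of_mem _ hc)
    simp only [List.length_cons]
    omega

/-- Every reset word for the Černý automaton `𝒞ₙ` has length at least `(n-1)²`. -/
theorem cerny_automaton_lower_bound (n : ℕ) (hn : 2 ≤ n)
    (w : List Letter) (hw : IsReset n w) :
    (n - 1) ^ 2 ≤ w.length := by
  obtain ⟨p, hp⟩ := hw
  obtain ⟨g, ⟨hg1, hgn⟩, hle⟩ := exists_weight_le_length (S := Set.Icc 1 n) hn w subset_rfl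
    ⟨1, le_rfl, by omega⟩ fun q hq => hp q (Finset.mem_Icc.2 hq)
  have hc := hle _ (delta_mem_Icc ⟨hg1, hgn⟩ .b)
  have hd : cycleDist n (delta n g .b) g = n - 1 := by
    simp only [cycleDist, delta]
    split_ifs <;> omega
  have hsq : n * (n - 1) = (n - 1) ^ 2 + (n - 1) := by
    obtain ⟨k, rfl⟩ := Nat.exists_eq_add_of_le' hn
    simp only [show k + 2 - 1 = k + 1 by omega]
    ring
  simp only [weight, hd] at hc
  omega
end

section
/- For every integer n ≥ 2, every reset word of minimum length for the Černý automaton 𝒞_n contains no occurrence of aa as a factor, i.e., every occurrence of the letter a in it, except possibly the last letter, is immediately followed by the letter b. -/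
/-- For `n ≥ 2`, the letter `a` acts idempotently on the states of `𝒞ₙ`. -/
theorem delta_a_idem {n : ℕ} (hn : 2 ≤ n) (q : ℕ) :
    delta n (delta n q Letter.a) Letter.a = delta n q Letter.a := by
  simp only [delta]
  split_ifs <;> omega

/-- Every reset word of minimum length for the Černý automaton `𝒞ₙ` contains no
occurrence of `aa` as a factor. -/
theorem cerny_min_reset_word_no_aa (n : ℕ) (hn : 2 ≤ n)
    (w : List Letter) (hw : IsReset n w)
    (hmin : ∀ v : List Letter, IsReset n v → w.length ≤ v.length) :
    ∀ u v : List Letter, w ≠ u ++ [Letter.a, Letter.a] ++ v := by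
  rintro u v rfl
  obtain ⟨p, hp⟩ := hw
  have hreset : IsReset n (u ++ [Letter.a] ++ v) :=
    ⟨p, fun q hq => by simpa [List.foldl_append, delta_a_idem hn] using hp q hq⟩
  have hlen := hmin _ hreset
  simp at hlen
end
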